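/- There is no C¹ function f : 𝔻 → 𝔻_{1/10} ⊆ ℂ which is continuously differentiable on {f ≠ 0}, satisfies ∂f/∂z̄ = |f|^{1/2} there, and has f(0) ≠ 0. In other words, any continuous solution of ∂f/∂z̄ = |f|^{1/2} on the unit disc with sup |f| < 1/10 must satisfy f(0) = 0. -/

import Mathlib

open Metric

/-- The Wirtinger derivative ∂f/∂z̄ = (1/2)(∂f/∂x + i ∂f/∂y). -/
noncomputable def wbar (f : ℂ → ℂ) (z : ℂ) : ℂ :=
  (1 / 2 : ℂ) * (fderiv ℝ f z 1 + Complex.I * fderiv ℝ f z Complex.I)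

open Filter Topology Complex ComplexConjugate intervalIntegral MeasureTheory

/-- The point `exp (iθ)` of the unit circle. -/
noncomputable def unitExp (θ : ℝ) : ℂ := Complex.exp (θ * I)

theorem norm_unitExp (θ : ℝ) : ‖unitExp θ‖ = 1 := Complex.norm_exp_ofReal_mul_I θ

theorem continuous_unitExp : Continuous unitExp := by unfold unitExp; fun_prop

theorem hasDerivAt_unitExp (θ : ℝ) : HasDerivAt unitExp (I * unitExp θ) θ := by
  have h : HasDerivAt (fun t : ℝ => (t : ℂ) * I) (1 * I) θ :=
    (Complex.ofRealCLM.hasDerivAt (x := θ)).mul_const I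
  have h2 := h.cexp
  rw [one_mul, mul_comm] at h2
  exact h2

theorem unitExp_zero : unitExp 0 = 1 := by simp [unitExp]

theorem unitExp_two_pi : unitExp (2 * Real.pi) = 1 := by
  simp [unitExp, Complex.exp_two_pi_mul_I]

theorem unitExp_mul_conj (θ : ℝ) : unitExp θ * conj (unitExp θ) = 1 := by
  rw [Complex.mul_conj, Complex.normSq_eq_norm_sq, norm_unitExp]; simp

theorem integral_unitExp : ∫ θ in (0 : ℝ)..2 * Real.pi, unitExp θ = 0 := by
  have h := integral_eq_sub_of_hasDerivAt (a := 0) (b := 2 * Real.pi)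
    (fun θ _ => hasDerivAt_unitExp θ)
    ((continuous_const.mul continuous_unitExp).intervalIntegrable _ _)
  rw [intervalIntegral.integral_const_mul, unitExp_zero, unitExp_two_pi, sub_self] at h
  simpa using h

theorem integral_conj_unitExp : ∫ θ in (0 : ℝ)..2 * Real.pi, conj (unitExp θ) = 0 := by
  rw [intervalIntegral_conj, integral_unitExp, map_zero]

theorem integral_unitExp_sq : ∫ θ in (0 : ℝ)..2 * Real.pi, unitExp θ ^ 2 = 0 := by
  have h := integral_eq_sub_of_hasDerivAt (a := 0) (b := 2 * Real.pi)
    (f := fun θ => unitExp θ ^ 2) (f' := fun θ => (2 * I) * unitExp θ ^ 2)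
    (fun θ _ => by
      have h := (hasDerivAt_unitExp θ).mul (hasDerivAt_unitExp θ)
      rw [show 2 * I * unitExp θ ^ 2
        = I * unitExp θ * unitExp θ + unitExp θ * (I * unitExp θ) by ring]
      simp_rw [sq]
      exact h)
    ((continuous_const.mul (continuous_unitExp.pow 2)).intervalIntegrable _ _)
  rw [intervalIntegral.integral_const_mul, unitExp_zero, unitExp_two_pi, sub_self] at h
  simpa using h

theorem integral_conj_unitExp_sq :
    ∫ θ in (0 : ℝ)..2 * Real.pi, conj (unitExp θ) ^ 2 = 0 := by
  simp_rw [← map_pow]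
  rw [intervalIntegral_conj, integral_unitExp_sq, map_zero]

/-- The Wirtinger derivative `∂/∂z` of a real-linear map. -/
noncomputable def linDz (L : ℂ →L[ℝ] ℂ) : ℂ := (1 / 2 : ℂ) * (L 1 - I * L I)

/-- The Wirtinger derivative `∂/∂z̄` of a real-linear map. -/
noncomputable def linDzbar (L : ℂ →L[ℝ] ℂ) : ℂ := (1 / 2 : ℂ) * (L 1 + I * L I)

theorem apply_eq_linDz_linDzbar (L : ℂ →L[ℝ] ℂ) (v : ℂ) :
    L v = linDz L * v + linDzbar L * conj v := by
  have hv : L v = v.re * L 1 + v.im * L I := by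
    conv_lhs => rw [show v = v.re • (1 : ℂ) + v.im • I by simp [Complex.re_add_im]]
    rw [map_add, map_smul, map_smul]; simp
  rw [hv, linDz, linDzbar]
  conv_rhs => rw [show conj v = v.re - v.im * I by
    apply Complex.ext <;> simp]
  conv_rhs => rw [← Complex.re_add_im v]
  simp only [add_re, ofReal_re, mul_re, I_re, mul_zero, ofReal_im, I_im, mul_one, sub_self,
    add_zero, add_im, mul_im, zero_add]
  linear_combination ((v.im : ℂ) * L I) * Complex.I_sq

theorem integral_linear_mul_conj_unitExp (L : ℂ →L[ℝ] ℂ) :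
    ∫ θ in (0 : ℝ)..2 * Real.pi, L (unitExp θ) * conj (unitExp θ)
      = 2 * Real.pi * linDz L := by
  have h : ∀ θ, L (unitExp θ) * conj (unitExp θ)
      = linDz L + linDzbar L * conj (unitExp θ) ^ 2 := fun θ => by
    rw [apply_eq_linDz_linDzbar L]
    linear_combination linDz L * unitExp_mul_conj θ
  simp_rw [h]
  have hc := continuous_unitExp
  rw [intervalIntegral.integral_add intervalIntegrable_const
    (Continuous.intervalIntegrable (by fun_prop) _ _), intervalIntegral.integral_const_mul,
    integral_conj_unitExp_sq]
  simp

theorem integral_norm_sq_linear_unitExp (L : ℂ →L[ℝ] ℂ) :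
    ∫ θ in (0 : ℝ)..2 * Real.pi, ‖L (unitExp θ)‖ ^ 2
      = 2 * Real.pi * (‖linDz L‖ ^ 2 + ‖linDzbar L‖ ^ 2) := by
  have h : ∀ θ, ((‖L (unitExp θ)‖ ^ 2 : ℝ) : ℂ)
      = ((‖linDz L‖ ^ 2 + ‖linDzbar L‖ ^ 2 : ℝ) : ℂ) +
        (linDz L * conj (linDzbar L)) * unitExp θ ^ 2
        + (linDzbar L * conj (linDz L)) * conj (unitExp θ) ^ 2 := fun θ => by
    have e1 := unitExp_mul_conj θ
    push_cast
    simp only [← Complex.mul_conj']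
    rw [apply_eq_linDz_linDzbar L]
    simp only [map_add, map_mul, Complex.conj_conj]
    linear_combination
      (linDz L * conj (linDz L) + linDzbar L * conj (linDzbar L)) * e1
  have hc := continuous_unitExp
  apply Complex.ofReal_injective
  rw [← intervalIntegral.integral_ofReal]
  simp_rw [h]
  rw [intervalIntegral.integral_add (Continuous.intervalIntegrable (by fun_prop) _ _)
    (Continuous.intervalIntegrable (by fun_prop) _ _), intervalIntegral.integral_add intervalIntegrable_const
    (Continuous.intervalIntegrable (by fun_prop) _ _), intervalIntegral.integral_const_mul,
    intervalIntegral.integral_const_mul, integral_conj_unitExp_sq, integral_unitExp_sq]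
  simp [mul_add]

theorem eventually_circle {P : ℂ → Prop} {p : ℂ} (h : ∀ᶠ z in 𝓝 p, P z) :
    ∀ᶠ r : ℝ in 𝓝[>] 0, ∀ θ : ℝ, P (p + r * unitExp θ) := by
  obtain ⟨δ, hδ, hP⟩ := Metric.eventually_nhds_iff.1 h
  filter_upwards [Ioo_mem_nhdsGT hδ] with r hr θ
  apply hP
  simp [norm_unitExp, abs_of_pos hr.1, hr.2]

/-- Circle means of a function of the difference quotients converge to the mean of that function
of the derivative. -/
theorem tendsto_integral_differenceQuotient {E F : Type*} [NormedAddCommGroup E] [NormedSpace ℝ E]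
    [ProperSpace E] [NormedAddCommGroup F] [NormedSpace ℝ F] {g : ℂ → E} {g' : ℂ →L[ℝ] E} {p : ℂ}
    (hg : HasFDerivAt g g' p) (hc : ∀ᶠ z in 𝓝 p, ContinuousAt g z) {Φ : ℝ × E → F}
    (hΦ : Continuous Φ) :
    Tendsto (fun r : ℝ => ∫ θ in (0 : ℝ)..2 * Real.pi,
        Φ (θ, r⁻¹ • (g (p + r * unitExp θ) - g p))) (𝓝[>] 0)
      (𝓝 (∫ θ in (0 : ℝ)..2 * Real.pi, Φ (θ, g' (unitExp θ)))) := by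
  have hu := continuous_unitExp
  obtain ⟨C, hC⟩ := hg.isBigO_sub.bound
  obtain ⟨B, hB⟩ := ((isCompact_uIcc (a := (0 : ℝ)) (b := 2 * Real.pi)).prod
    (isCompact_closedBall (0 : E) C)).exists_bound_of_continuousOn hΦ.continuousOn
  apply intervalIntegral.tendsto_integral_filter_of_dominated_convergence (fun _ => B)
  · filter_upwards [eventually_circle hc] with r hr
    apply Continuous.aestronglyMeasurable
    refine hΦ.comp (continuous_id.prodMk (continuous_const.smul (Continuous.sub ?_
      continuous_const)))
    exact continuous_iff_continuousAt.2 fun θ =>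
      (hr θ).comp (f := fun θ : ℝ => p + r * unitExp θ) (by fun_prop)
  · filter_upwards [eventually_circle hC, self_mem_nhdsWithin] with r hr hr0
    refine Eventually.of_forall fun θ hθ => hB _ ⟨Set.uIoc_subset_uIcc hθ, ?_⟩
    have hr0 : 0 < r := hr0
    have := hr θ
    simp only [add_sub_cancel_left, norm_mul, norm_unitExp, mul_one, norm_real,
      Real.norm_of_nonneg hr0.le] at this
    rw [mem_closedBall_zero_iff, norm_smul, norm_inv, Real.norm_of_nonneg hr0.le,
      inv_mul_le_iff₀ hr0, mul_comm r]
    exact this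
  · exact intervalIntegrable_const
  · refine Eventually.of_forall fun θ _ => ?_
    refine (hΦ.tendsto _).comp (tendsto_const_nhds.prodMk_nhds ?_)
    have h1 : HasDerivAt (fun r : ℝ => p + r * unitExp θ) (unitExp θ) 0 := by
      simpa using ((Complex.ofRealCLM.hasDerivAt (x := 0)).mul_const (unitExp θ)).const_add p
    have h2 : HasDerivAt (fun r : ℝ => g (p + r * unitExp θ)) (g' (unitExp θ)) 0 := by
      refine HasFDerivAt.comp_hasDerivAt (0 : ℝ) ?_ h1
      simpa using hg
    have := h2.tendsto_slope.mono_left (nhdsGT_le_nhdsNE (0 : ℝ))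
    refine this.congr fun r => ?_
    simp [slope_def_module]

/-- The radial derivative of the circle mean only involves the `∂/∂z̄` derivative. -/
theorem hasDerivAt_circle_integral {f : ℂ → ℂ} {p : ℂ} {δ : ℝ}
    (hf : ContDiffOn ℝ 1 f (ball p δ)) {r : ℝ} (hr : r ∈ Set.Ioo 0 δ) :
    HasDerivAt (fun r : ℝ => ∫ θ in (0 : ℝ)..2 * Real.pi, f (p + r * unitExp θ))
      (2 * ∫ θ in (0 : ℝ)..2 * Real.pi, wbar f (p + r * unitExp θ) * conj (unitExp θ)) r := by
  have hu := continuous_unitExp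
  have hmem : ∀ s ∈ Set.Ioo 0 δ, ∀ θ, p + s * unitExp θ ∈ ball p δ := fun s hs θ => by
    simp [norm_unitExp, abs_of_pos hs.1, hs.2]
  have hdf : ∀ z ∈ ball p δ, HasFDerivAt f (fderiv ℝ f z) z := fun z hz =>
    ((hf.differentiableOn one_ne_zero z hz).differentiableAt (isOpen_ball.mem_nhds hz)).hasFDerivAt
  have hcf' : ContinuousOn (fderiv ℝ f) (ball p δ) :=
    hf.continuousOn_fderiv_of_isOpen isOpen_ball le_rfl
  have hcirc : ∀ s : ℝ, Continuous fun θ : ℝ => p + s * unitExp θ := fun s => by fun_prop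
  have hcontf : ∀ s ∈ Set.Ioo 0 δ, Continuous fun θ : ℝ => f (p + s * unitExp θ) := fun s hs =>
    hf.continuousOn.comp_continuous (hcirc s) (hmem s hs)
  have hcontf' : Continuous fun θ : ℝ => fderiv ℝ f (p + r * unitExp θ) :=
    hcf'.comp_continuous (hcirc r) (hmem r hr)
  obtain ⟨ρ, hrρ, hρδ⟩ := exists_between hr.2
  obtain ⟨C, hC⟩ := (isCompact_closedBall p ρ).exists_bound_of_continuousOn
    (hcf'.mono (closedBall_subset_ball hρδ))
  have key := (intervalIntegral.hasDerivAt_integral_of_dominated_loc_of_deriv_le (μ := volume) (x₀ := r) (a := 0)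
    (b := 2 * Real.pi) (F := fun (s : ℝ) θ => f (p + s * unitExp θ))
    (F' := fun (s : ℝ) θ => fderiv ℝ f (p + s * unitExp θ) (unitExp θ)) (bound := fun _ => C)
    (Ioo_mem_nhds hr.1 hrρ) ?_ ((hcontf r hr).intervalIntegrable _ _)
    (hcontf'.clm_apply hu).aestronglyMeasurable ?_ intervalIntegrable_const ?_).2
  · have hang : ∫ θ in (0 : ℝ)..2 * Real.pi,
        fderiv ℝ f (p + r * unitExp θ) (r * (I * unitExp θ)) = 0 := by
      rw [integral_eq_sub_of_hasDerivAt (f := fun θ : ℝ => f (p + r * unitExp θ))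
        (fun θ _ => (hdf _ (hmem r hr θ)).comp_hasDerivAt θ
          (((hasDerivAt_unitExp θ).const_mul (r : ℂ)).const_add p))
        ((hcontf'.clm_apply (by fun_prop)).intervalIntegrable _ _)]
      simp [unitExp_zero, unitExp_two_pi]
    have hpt : ∀ θ, fderiv ℝ f (p + r * unitExp θ) (unitExp θ)
        = 2 * (wbar f (p + r * unitExp θ) * conj (unitExp θ))
          + (-I * (r : ℂ)⁻¹) * fderiv ℝ f (p + r * unitExp θ) (r * (I * unitExp θ)) := fun θ => by
      have hr0 : (r : ℂ) ≠ 0 := by exact_mod_cast hr.1.ne'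
      rw [apply_eq_linDz_linDzbar _ (unitExp θ), apply_eq_linDz_linDzbar _ (_ * _)]
      simp only [wbar, linDzbar, map_mul, conj_ofReal, conj_I]
      field_simp
      linear_combination (linDz (fderiv ℝ f (p + r * unitExp θ)) * unitExp θ * 2 -
        conj (unitExp θ) * ((fderiv ℝ f (p + r * unitExp θ)) 1 +
          I * (fderiv ℝ f (p + r * unitExp θ)) I)) * Complex.I_sq
    refine key.congr_deriv ?_
    rw [intervalIntegral.integral_congr fun θ _ => hpt θ, intervalIntegral.integral_add, intervalIntegral.integral_const_mul,
      intervalIntegral.integral_const_mul, hang, mul_zero, add_zero]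
    · apply Continuous.intervalIntegrable
      have h1 : Continuous fun θ : ℝ => fderiv ℝ f (p + r * unitExp θ) 1 :=
        hcontf'.clm_apply continuous_const
      have h2 : Continuous fun θ : ℝ => fderiv ℝ f (p + r * unitExp θ) I :=
        hcontf'.clm_apply continuous_const
      unfold wbar
      fun_prop
    · exact (continuous_const.mul (hcontf'.clm_apply (by fun_prop))).intervalIntegrable _ _
  · filter_upwards [Ioo_mem_nhds hr.1 hr.2] with s hs
    exact (hcontf s hs).aestronglyMeasurable
  · refine Eventually.of_forall fun θ _ s hs => ?_
    refine (ContinuousLinearMap.le_opNorm _ _).trans ?_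
    rw [norm_unitExp, mul_one]
    exact hC _ (by simp [norm_unitExp, abs_of_pos hs.1, hs.2.le])
  · refine Eventually.of_forall fun θ _ s hs => ?_
    refine (hdf _ (hmem s ⟨hs.1, hs.2.trans hρδ⟩ θ)).comp_hasDerivAt s ?_
    simpa using ((Complex.ofRealCLM.hasDerivAt (x := s)).mul_const (unitExp θ)).const_add p

theorem continuous_circle {E : Type*} [TopologicalSpace E] {g : ℂ → E} {p : ℂ} {r : ℝ}
    (h : ∀ θ, ContinuousAt g (p + r * unitExp θ)) :
    Continuous fun θ : ℝ => g (p + r * unitExp θ) := by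
  have hu := continuous_unitExp
  exact continuous_iff_continuousAt.2 fun θ =>
    (h θ).comp (f := fun θ : ℝ => p + r * unitExp θ) (by fun_prop)

/-- Second order expansion of the circle means of `f` at a point where `∂f/∂z̄` is
differentiable. -/
theorem tendsto_circle_integral_div_sq {f : ℂ → ℂ} {p : ℂ} {δ : ℝ} (hδ : 0 < δ)
    (hf : ContDiffOn ℝ 1 f (ball p δ)) {H : ℂ →L[ℝ] ℂ} (hH : HasFDerivAt (wbar f) H p)
    (hw : ∀ᶠ z in 𝓝 p, ContinuousAt (wbar f) z) (k : ℂ) :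
    Tendsto (fun r : ℝ => (k * ∫ θ in (0 : ℝ)..2 * Real.pi, (f (p + r * unitExp θ) - f p)).re
      / r ^ 2) (𝓝[>] 0) (𝓝 (2 * Real.pi * (k * linDz H).re)) := by
  have hu := continuous_unitExp
  have hball : ∀ᶠ z in 𝓝 p, z ∈ ball p δ := ball_mem_nhds p hδ
  have hcf : ∀ᶠ z in 𝓝 p, ContinuousAt f z := hball.mono fun z hz =>
    hf.continuousOn.continuousAt (isOpen_ball.mem_nhds hz)
  have hd : HasFDerivAt f (fderiv ℝ f p) p :=
    ((hf.differentiableOn one_ne_zero p (mem_ball_self hδ)).differentiableAt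
      (ball_mem_nhds p hδ)).hasFDerivAt
  refine HasDerivAt.lhopital_zero_nhdsGT (f' := fun r : ℝ =>
    (k * (2 * ∫ θ in (0 : ℝ)..2 * Real.pi, wbar f (p + r * unitExp θ) * conj (unitExp θ))).re)
    (g' := fun r => 2 * r) ?_ ?_ ?_ ?_ ?_ ?_
  · filter_upwards [Ioo_mem_nhdsGT hδ] with r hr
    have h1 := ((hasDerivAt_circle_integral hf hr).sub_const (2 * Real.pi * f p)).const_mul k
    have h2 := (Complex.reCLM.hasFDerivAt (x := _)).comp_hasDerivAt r h1
    refine h2.congr_of_eventuallyEq ?_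
    filter_upwards [Ioo_mem_nhds hr.1 hr.2] with s hs
    rw [intervalIntegral.integral_sub ((continuous_circle fun θ => ?_).intervalIntegrable _ _)
      intervalIntegrable_const]
    · simp
    · refine hf.continuousOn.continuousAt (isOpen_ball.mem_nhds ?_)
      simp [norm_unitExp, abs_of_pos hs.1, hs.2]
  · exact Eventually.of_forall fun r => by simpa using hasDerivAt_pow 2 r
  · filter_upwards [self_mem_nhdsWithin] with r hr
    exact mul_ne_zero two_ne_zero (ne_of_gt hr)
  · have h1 := tendsto_integral_differenceQuotient hd hcf (Φ := Prod.snd) continuous_snd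
    have h2 : Tendsto (fun r : ℝ => r) (𝓝[>] 0) (𝓝 0) := tendsto_nhdsWithin_of_tendsto_nhds tendsto_id
    have h3 := h2.smul h1
    rw [zero_smul] at h3
    have h4 := (Complex.continuous_re.tendsto _).comp (h3.const_mul k)
    rw [mul_zero, Complex.zero_re] at h4
    refine h4.congr' ?_
    filter_upwards [self_mem_nhdsWithin] with r hr
    have hr : r ≠ 0 := ne_of_gt hr
    simp only [Function.comp_apply, intervalIntegral.integral_smul, smul_inv_smul₀ hr]
  · have : Tendsto (fun r : ℝ => r ^ 2) (𝓝 0) (𝓝 (0 ^ 2)) := (continuous_pow 2).tendsto 0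
    rw [zero_pow two_ne_zero] at this
    exact this.mono_left nhdsWithin_le_nhds
  · have h1 := tendsto_integral_differenceQuotient hH hw
      (Φ := fun q : ℝ × ℂ => q.2 * conj (unitExp q.1)) (by fun_prop)
    rw [integral_linear_mul_conj_unitExp] at h1
    have h2 := (Complex.continuous_re.tendsto _).comp (h1.const_mul k)
    have e : (k * (2 * Real.pi * linDz H)).re = 2 * Real.pi * (k * linDz H).re := by
      rw [← Complex.re_ofReal_mul]; push_cast; ring_nf
    rw [e] at h2
    refine h2.congr' ?_
    filter_upwards [eventually_circle hw, self_mem_nhdsWithin] with r hc hr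
    have hr : r ≠ 0 := ne_of_gt hr
    have hcc := continuous_circle hc
    simp only [Function.comp_apply, smul_mul_assoc, intervalIntegral.integral_smul, sub_mul]
    rw [intervalIntegral.integral_sub (Continuous.intervalIntegrable (by fun_prop) _ _)
      (Continuous.intervalIntegrable (by fun_prop) _ _), intervalIntegral.integral_const_mul,
      integral_conj_unitExp, mul_zero, sub_zero, Complex.real_smul, mul_left_comm,
      mul_left_comm k 2, Complex.re_ofReal_mul,
      show (2 : ℂ) = ((2 : ℝ) : ℂ) by norm_num, Complex.re_ofReal_mul]
    field_simp

/-- Circle means of the comparison function. -/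
theorem integral_add_mul_normSq_circle_sq (u c r : ℝ) (p : ℂ) :
    ∫ θ in (0 : ℝ)..2 * Real.pi, (u + c * ‖p + r * unitExp θ‖ ^ 2) ^ 2
      = 2 * Real.pi * ((u + c * ‖p‖ ^ 2 + c * r ^ 2) ^ 2 + 2 * c ^ 2 * r ^ 2 * ‖p‖ ^ 2) := by
  have hu := continuous_unitExp
  have h : ∀ θ, (((u + c * ‖p + r * unitExp θ‖ ^ 2) ^ 2 : ℝ) : ℂ)
      = (((u + c * ‖p‖ ^ 2 + c * r ^ 2) ^ 2 + 2 * c ^ 2 * r ^ 2 * ‖p‖ ^ 2 : ℝ) : ℂ)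
        + ((2 * (u + c * ‖p‖ ^ 2 + c * r ^ 2) * c * r * conj p) * unitExp θ
        + ((2 * (u + c * ‖p‖ ^ 2 + c * r ^ 2) * c * r * p) * conj (unitExp θ)
        + ((c ^ 2 * r ^ 2 * conj p ^ 2) * unitExp θ ^ 2
        + (c ^ 2 * r ^ 2 * p ^ 2) * conj (unitExp θ) ^ 2))) := fun θ => by
    have e1 := unitExp_mul_conj θ
    have e2 : ((‖p + r * unitExp θ‖ ^ 2 : ℝ) : ℂ) = ((‖p‖ ^ 2 : ℝ) : ℂ) + r ^ 2
        + r * (p * conj (unitExp θ) + conj p * unitExp θ) := by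
      push_cast
      simp only [← Complex.mul_conj', map_add, map_mul, Complex.conj_ofReal]
      linear_combination (r : ℂ) ^ 2 * e1
    have e3 := Complex.mul_conj' p
    push_cast at e2 ⊢
    rw [e2]
    rw [← e3]
    linear_combination (2 * c ^ 2 * r ^ 2 * p * conj p : ℂ) * e1
  apply Complex.ofReal_injective
  rw [← intervalIntegral.integral_ofReal]
  simp_rw [h]
  rw [intervalIntegral.integral_add intervalIntegrable_const
      (Continuous.intervalIntegrable (by fun_prop) _ _),
    intervalIntegral.integral_add (Continuous.intervalIntegrable (by fun_prop) _ _)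
      (Continuous.intervalIntegrable (by fun_prop) _ _),
    intervalIntegral.integral_add (Continuous.intervalIntegrable (by fun_prop) _ _)
      (Continuous.intervalIntegrable (by fun_prop) _ _),
    intervalIntegral.integral_add (Continuous.intervalIntegrable (by fun_prop) _ _)
      (Continuous.intervalIntegrable (by fun_prop) _ _),
    intervalIntegral.integral_const_mul, intervalIntegral.integral_const_mul,
    intervalIntegral.integral_const_mul, intervalIntegral.integral_const_mul,
    integral_conj_unitExp_sq, integral_unitExp_sq, integral_conj_unitExp, integral_unitExp]
  simp
  ring

/-- The second order necessary condition at a point where `‖f‖` touches a paraboloid from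
below. -/
theorem second_order_condition {f : ℂ → ℂ} {p : ℂ} {δ u c : ℝ} (hδ : 0 < δ)
    (hf : ContDiffOn ℝ 1 f (ball p δ)) {H : ℂ →L[ℝ] ℂ} (hH : HasFDerivAt (wbar f) H p)
    (hw : ∀ᶠ z in 𝓝 p, ContinuousAt (wbar f) z) (hp : ‖f p‖ = u + c * ‖p‖ ^ 2)
    (hmax : ∀ᶠ z in 𝓝 p, ‖f z‖ ≤ u + c * ‖z‖ ^ 2) :
    2 * (conj (f p) * linDz H).re + (‖linDz (fderiv ℝ f p)‖ ^ 2 + ‖linDzbar (fderiv ℝ f p)‖ ^ 2)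
      ≤ 2 * c * ‖f p‖ + 2 * c ^ 2 * ‖p‖ ^ 2 := by
  have hball : ∀ᶠ z in 𝓝 p, z ∈ ball p δ := ball_mem_nhds p hδ
  have hcf : ∀ᶠ z in 𝓝 p, ContinuousAt f z := hball.mono fun z hz =>
    hf.continuousOn.continuousAt (isOpen_ball.mem_nhds hz)
  have hd : HasFDerivAt f (fderiv ℝ f p) p :=
    ((hf.differentiableOn one_ne_zero p (mem_ball_self hδ)).differentiableAt
      (ball_mem_nhds p hδ)).hasFDerivAt
  have h1 := tendsto_circle_integral_div_sq hδ hf hH hw (conj (f p))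
  have h2 := tendsto_integral_differenceQuotient hd hcf
    (Φ := fun q : ℝ × ℂ => ‖q.2‖ ^ 2) (by fun_prop)
  rw [integral_norm_sq_linear_unitExp] at h2
  have h3 : Tendsto (fun r : ℝ => 2 * Real.pi * (2 * c * ‖f p‖ + c ^ 2 * r ^ 2
      + 2 * c ^ 2 * ‖p‖ ^ 2)) (𝓝[>] 0)
      (𝓝 (2 * Real.pi * (2 * c * ‖f p‖ + c ^ 2 * 0 ^ 2 + 2 * c ^ 2 * ‖p‖ ^ 2))) :=
    tendsto_nhdsWithin_of_tendsto_nhds (Continuous.tendsto (by fun_prop) _)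
  have h4 := le_of_tendsto_of_tendsto ((h1.const_mul 2).add h2) h3 ?_
  · refine le_of_mul_le_mul_left ?_ Real.two_pi_pos
    linarith
  filter_upwards [eventually_circle hcf, eventually_circle hmax, self_mem_nhdsWithin]
    with r hc hm hr
  have hr : 0 < r := hr
  have hcc := continuous_circle hc
  have hu := continuous_unitExp
  have hint : ∫ θ in (0 : ℝ)..2 * Real.pi, ‖f (p + r * unitExp θ)‖ ^ 2
      ≤ ∫ θ in (0 : ℝ)..2 * Real.pi, (u + c * ‖p + r * unitExp θ‖ ^ 2) ^ 2 :=
    intervalIntegral.integral_mono_on Real.two_pi_pos.le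
      ((hcc.norm.pow 2).intervalIntegrable _ _)
      (Continuous.intervalIntegrable (by fun_prop) _ _)
      fun θ _ => pow_le_pow_left₀ (norm_nonneg _) (hm θ) 2
  rw [integral_add_mul_normSq_circle_sq, ← hp] at hint
  have hexp : ∀ θ, ‖f (p + r * unitExp θ)‖ ^ 2 = ‖f p‖ ^ 2
      + (2 * (conj (f p) * (f (p + r * unitExp θ) - f p)).re
      + r ^ 2 * ‖r⁻¹ • (f (p + r * unitExp θ) - f p)‖ ^ 2) := fun θ => by
    rw [norm_smul, mul_pow, norm_inv, Real.norm_of_nonneg hr.le, ← mul_assoc, ← mul_pow,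
      mul_inv_cancel₀ hr.ne']
    simp only [← Complex.normSq_eq_norm_sq, Complex.normSq_apply, mul_re, conj_re, conj_im, sub_re,
      sub_im]
    ring
  have hcd : Continuous fun θ : ℝ => conj (f p) * (f (p + r * unitExp θ) - f p) :=
    continuous_const.mul (hcc.sub continuous_const)
  have hc1 : Continuous fun θ : ℝ => 2 * (conj (f p) * (f (p + r * unitExp θ) - f p)).re :=
    continuous_const.mul (Complex.continuous_re.comp hcd)
  have hc2 : Continuous fun θ : ℝ => r ^ 2 * ‖r⁻¹ • (f (p + r * unitExp θ) - f p)‖ ^ 2 :=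
    (((hcc.sub (continuous_const (y := f p))).const_smul r⁻¹).norm.pow 2).const_mul _
  have hc12 : Continuous fun θ : ℝ => 2 * (conj (f p) * (f (p + r * unitExp θ) - f p)).re
      + r ^ 2 * ‖r⁻¹ • (f (p + r * unitExp θ) - f p)‖ ^ 2 := hc1.add hc2
  have hre : ∫ θ in (0 : ℝ)..2 * Real.pi, (conj (f p) * (f (p + r * unitExp θ) - f p)).re
      = (conj (f p) * ∫ θ in (0 : ℝ)..2 * Real.pi, (f (p + r * unitExp θ) - f p)).re := by
    rw [← intervalIntegral.integral_const_mul]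
    exact Complex.reCLM.intervalIntegral_comp_comm
      (hcd.intervalIntegrable _ _)
  simp_rw [hexp] at hint
  rw [intervalIntegral.integral_add intervalIntegrable_const
      (hc12.intervalIntegrable _ _),
    intervalIntegral.integral_add (hc1.intervalIntegrable _ _)
      (hc2.intervalIntegrable _ _),
    intervalIntegral.integral_const_mul, intervalIntegral.integral_const_mul, hre] at hint
  simp only [intervalIntegral.integral_const, smul_eq_mul, sub_zero] at hint
  refine le_of_mul_le_mul_left ?_ (pow_pos hr 2)
  have e : ∀ x y : ℝ, r ^ 2 * (2 * (x / r ^ 2) + y) = 2 * x + r ^ 2 * y := fun x y => by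
    field_simp
  rw [e]
  linarith

/-- The first order necessary condition at a point where `‖f‖` touches a paraboloid from below. -/
theorem first_order_condition {f : ℂ → ℂ} {L : ℂ →L[ℝ] ℂ} {p : ℂ} {u c : ℝ}
    (hd : HasFDerivAt f L p) (hp : ‖f p‖ = u + c * ‖p‖ ^ 2)
    (hmax : ∀ᶠ z in 𝓝 p, ‖f z‖ ≤ u + c * ‖z‖ ^ 2) (v : ℂ) :
    inner ℝ (f p) (L v) = 2 * c * ‖f p‖ * inner ℝ p v := by
  have h1 := hd.norm_sq
  have h2 := (((hasFDerivAt_id (𝕜 := ℝ) p).norm_sq.const_mul c).const_add u).pow 2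
  have hloc : IsLocalMax (fun z => ‖f z‖ ^ 2 - (u + c * ‖z‖ ^ 2) ^ 2) p := by
    filter_upwards [hmax] with z hz
    rw [← hp, sub_self, sub_nonpos]
    exact pow_le_pow_left₀ (norm_nonneg _) hz 2
  have h3 := DFunLike.congr_fun (hloc.hasFDerivAt_eq_zero (h1.sub h2)) v
  simp [Complex.inner] at h3 ⊢
  rw [hp]
  linarith

/-- The derivative of `‖f‖ ^ (1 / 2)` at a point where the first order condition holds. -/
theorem hasFDerivAt_sqrt_norm {f : ℂ → ℂ} {L : ℂ →L[ℝ] ℂ} {p : ℂ} {c q : ℝ}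
    (hd : HasFDerivAt f L p) (hq : 0 < q) (hqp : ‖f p‖ = q ^ 2)
    (h : ∀ v, inner ℝ (f p) (L v) = 2 * c * ‖f p‖ * inner ℝ p v) :
    HasFDerivAt (fun z => ((‖f z‖ ^ ((1 : ℝ) / 2) : ℝ) : ℂ))
      (Complex.ofRealCLM.comp ((c / q) • innerSL ℝ p)) p := by
  refine Complex.ofRealCLM.hasFDerivAt.comp p ?_
  have h0 : ‖f p‖ ^ 2 ≠ 0 := by rw [hqp]; positivity
  have h1 := hd.norm_sq.rpow_const (p := 1 / 4) (Or.inl h0)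
  refine (h1.congr_fderiv ?_).congr_of_eventuallyEq (Eventually.of_forall fun z => ?_)
  · ext1 v
    have e : (‖f p‖ ^ 2) ^ ((4 : ℝ)⁻¹ - 1) = (q ^ 3)⁻¹ := by
      rw [hqp, ← pow_mul, ← Real.rpow_natCast, ← Real.rpow_mul hq.le, ← Real.rpow_natCast,
        ← Real.rpow_neg hq.le]
      norm_num
    have hv := h v
    simp [Complex.inner, e] at hv ⊢
    rw [hqp] at hv
    rw [← mul_add, mul_comm (L v).re, mul_comm (L v).im]
    field_simp
    linarith
  · change ‖f z‖ ^ ((1 : ℝ) / 2) = (‖f z‖ ^ 2) ^ ((1 : ℝ) / 4)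
    rw [← Real.rpow_natCast, ← Real.rpow_mul (norm_nonneg _)]
    norm_num

/-- The algebraic incompatibility of the first and second order conditions, where `a + b i` is the
value of `f`, `q = |f|^{1/2}`, `w₁ + w₂ i = ∂f/∂z` and `x + y i` is the point. -/
theorem not_first_and_second_order {a b q w₁ w₂ x y : ℝ} (hq : 0 < q) (hab : q ^ 4 = a ^ 2 + b ^ 2)
    (h₁ : (w₁ + q) * a + w₂ * b = 2 * 5⁻¹ * q ^ 2 * x)
    (h₂ : -(w₂ * a) + (w₁ + -q) * b = 2 * 5⁻¹ * q ^ 2 * y)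
    (h : 2 * (a * (2⁻¹ * (5⁻¹ / q * x)) - b * (2⁻¹ * (5⁻¹ / q * y)))
      + (w₁ * w₁ + w₂ * w₂ + q * q) ≤ 2 * 5⁻¹ * q ^ 2 + 2 * (5 ^ 2)⁻¹ * (x * x + y * y)) :
    False := by
  have hw : q ^ 4 * (w₁ ^ 2 + w₂ ^ 2)
      = (2 / 5 * q ^ 2 * x - q * a) ^ 2 + (2 / 5 * q ^ 2 * y + q * b) ^ 2 := by
    rw [show 2 / 5 * q ^ 2 * x - q * a = w₁ * a + w₂ * b by linarith,
      show 2 / 5 * q ^ 2 * y + q * b = w₁ * b - w₂ * a by linarith, hab]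
    ring
  have hcs : (a * x - b * y) ^ 2 ≤ q ^ 4 * (x ^ 2 + y ^ 2) := by
    rw [hab]; nlinarith [sq_nonneg (a * y + b * x)]
  have h' := mul_le_mul_of_nonneg_left h (pow_pos hq 4).le
  have e : q ^ 4 * (2 * (a * (2⁻¹ * (5⁻¹ / q * x)) - b * (2⁻¹ * (5⁻¹ / q * y)))
      + (w₁ * w₁ + w₂ * w₂ + q * q))
      = q ^ 3 * (a * x - b * y) / 5 + q ^ 4 * (w₁ ^ 2 + w₂ ^ 2) + q ^ 6 := by
    field_simp
    ring
  rw [e, hw] at h'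
  have e2 : (q * a) ^ 2 + (q * b) ^ 2 = q ^ 6 := by
    linear_combination -q ^ 2 * hab
  have hq6 : 0 < q ^ 6 := by positivity
  nlinarith [sq_nonneg (a * x - b * y - 15 / 4 * q ^ 3)]

theorem stmt14 (f : ℂ → ℂ)
    (hcont : ContinuousOn f (ball (0 : ℂ) 1))
    (hmaps : Set.MapsTo f (ball (0 : ℂ) 1) (ball (0 : ℂ) (1 / 10)))
    (hC1 : ContDiffOn ℝ 1 f {z ∈ ball (0 : ℂ) 1 | f z ≠ 0})
    (heq : ∀ z ∈ ball (0 : ℂ) 1, f z ≠ 0 →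
      wbar f z = ((‖f z‖ ^ ((1 : ℝ) / 2) : ℝ) : ℂ)) :
    f 0 = 0 := by
  by_contra hf0
  have hsub : closedBall (0 : ℂ) (9 / 10) ⊆ ball 0 1 := closedBall_subset_ball (by norm_num)
  obtain ⟨p, hpK, hpmax⟩ := (isCompact_closedBall (0 : ℂ) (9 / 10)).exists_isMaxOn
    (nonempty_closedBall.2 (by norm_num)) (f := fun z => ‖f z‖ - 1 / 5 * ‖z‖ ^ 2)
    ((hcont.mono hsub).norm.sub (by fun_prop))
  have hu0 : 0 < ‖f p‖ - 1 / 5 * ‖p‖ ^ 2 := by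
    have h : ‖f 0‖ - 1 / 5 * ‖(0 : ℂ)‖ ^ 2 ≤ ‖f p‖ - 1 / 5 * ‖p‖ ^ 2 :=
      hpmax (mem_closedBall_self (by norm_num))
    have : 0 < ‖f 0‖ := norm_pos_iff.2 hf0
    simp at h
    linarith
  set u := ‖f p‖ - 1 / 5 * ‖p‖ ^ 2 with hu
  have hpos : 0 < ‖f p‖ := by nlinarith [sq_nonneg ‖p‖]
  have hp1 : p ∈ ball (0 : ℂ) 1 := hsub hpK
  have hplt : p ∈ ball (0 : ℂ) (9 / 10) := by
    have h1 : ‖f p‖ < 1 / 10 := by simpa using hmaps hp1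
    rw [mem_ball_zero_iff]
    by_contra! h
    nlinarith
  have hp : ‖f p‖ = u + 1 / 5 * ‖p‖ ^ 2 := by rw [hu]; ring
  have hmax : ∀ᶠ z in 𝓝 p, ‖f z‖ ≤ u + 1 / 5 * ‖z‖ ^ 2 := by
    filter_upwards [isOpen_ball.mem_nhds hplt] with z hz
    have h : ‖f z‖ - 1 / 5 * ‖z‖ ^ 2 ≤ u := hpmax (ball_subset_closedBall hz)
    linarith
  have hopen : IsOpen {z ∈ ball (0 : ℂ) 1 | f z ≠ 0} :=
    hcont.isOpen_inter_preimage isOpen_ball isOpen_compl_singleton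
  have hpU : p ∈ {z ∈ ball (0 : ℂ) 1 | f z ≠ 0} := ⟨hp1, norm_pos_iff.1 hpos⟩
  obtain ⟨δ, hδ, hδU⟩ := Metric.isOpen_iff.1 hopen p hpU
  have hd : HasFDerivAt f (fderiv ℝ f p) p :=
    ((hC1.differentiableOn one_ne_zero p hpU).differentiableAt (hopen.mem_nhds hpU)).hasFDerivAt
  have hev : ∀ᶠ z in 𝓝 p, wbar f z = ((‖f z‖ ^ ((1 : ℝ) / 2) : ℝ) : ℂ) := by
    filter_upwards [hopen.mem_nhds hpU] with z hz using heq z hz.1 hz.2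
  have hwc : ∀ᶠ z in 𝓝 p, ContinuousAt (wbar f) z := by
    filter_upwards [hev.eventually_nhds, hopen.mem_nhds hpU] with z hz hzU
    refine ContinuousAt.congr ?_ (hz.mono fun _ h => h.symm)
    exact Complex.continuous_ofReal.continuousAt.comp
      ((hcont.continuousAt (isOpen_ball.mem_nhds hzU.1)).norm.rpow_const (Or.inr (by norm_num)))
  obtain ⟨q, hq, hqp⟩ : ∃ q : ℝ, 0 < q ∧ ‖f p‖ = q ^ 2 :=
    ⟨√‖f p‖, Real.sqrt_pos.2 hpos, (Real.sq_sqrt hpos.le).symm⟩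
  have hfirst := first_order_condition hd hp hmax
  have hH := (hasFDerivAt_sqrt_norm hd hq hqp hfirst).congr_of_eventuallyEq hev
  have hsecond := second_order_condition hδ (hC1.mono hδU) hH hwc hp hmax
  have hbar : linDzbar (fderiv ℝ f p) = q := by
    have := heq p hp1 hpU.2
    rw [hqp, ← Real.sqrt_eq_rpow, Real.sqrt_sq hq.le] at this
    exact this
  have h1 := hfirst 1
  have h2 := hfirst I
  have hnp : q ^ 4 = (f p).re ^ 2 + (f p).im ^ 2 := by
    rw [show q ^ 4 = (q ^ 2) ^ 2 by ring, ← hqp, ← Complex.normSq_eq_norm_sq, Complex.normSq_apply]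
    ring
  rw [apply_eq_linDz_linDzbar, hbar, hqp] at h1 h2
  rw [hbar, hqp] at hsecond
  generalize linDz (fderiv ℝ f p) = w at *
  simp only [linDz, ← Complex.normSq_eq_norm_sq, Complex.normSq_apply] at hsecond
  simp [Complex.inner] at h1 h2 hsecond
  exact not_first_and_second_order hq hnp h1 h2 hsecond
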